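/- Assume in addition that q is not a root of unity. Let p = (ξ₁, ξ₂, ξ₃, 0) with ξ₁ξ₂ + κ²ξ₃² = 0 and ξ₃ ≠ 0 (a point of C), and let p′ = (η₁, η₂, 0, η₄) with η₁η₂ + κ²η₄² = 0 and η₄ ≠ 0 (a point of C′). Set X = ξ₃η₄E − ξ₁η₄K − ξ₃η₁K′, Y = ξ₃η₄F − ξ₂η₄K − ξ₃η₂K′, X′ = ξ₃η₄E − qξ₁η₄K − qξ₃η₁K′, Y′ = ξ₃η₄F − q⁻¹ξ₂η₄K − q⁻¹ξ₃η₂K′, so that S/(SX + SY) = M_{p,p′} and S/(SX′ + SY′) = M_{σp,σ⁻¹p′}, where σp = (qξ₁, q⁻¹ξ₂, ξ₃, 0) and σ⁻¹p′ = (qη₁, q⁻¹η₂, 0, η₄). Then: (i) X′K′ = qK′X and Y′K′ = q⁻¹K′Y in S; (ii) the map a + (SX′ + SY′) ↦ aK′ + (SX + SY) is a well-defined injective homomorphism of left S-modules from S/(SX′ + SY′) to S/(SX + SY) that raises degrees by 1, and its image is exactly the kernel of the canonical surjection S/(SX + SY) → S/(SX + SY + SK′). (This yields the exact sequence 0 →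 M_{σp,σ⁻¹p′}(−1) → M_{p,p′} → M_p → 0, where M_p = S/(SX + SY + SK′) is the point module of p.) -/

import Mathlib

noncomputable section

open FreeAlgebra

/-- The defining relations of the algebra `S`.
Generators: `0 ↦ E`, `1 ↦ F`, `2 ↦ K`, `3 ↦ K′`. -/
inductive SRel (q : ℂ) : FreeAlgebra ℂ (Fin 4) → FreeAlgebra ℂ (Fin 4) → Prop
  | KE : SRel q (ι ℂ 2 * ι ℂ 0) (q • (ι ℂ 0 * ι ℂ 2))
  | KF : SRel q (ι ℂ 2 * ι ℂ 1) (q⁻¹ • (ι ℂ 1 * ι ℂ 2))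
  | KK' : SRel q (ι ℂ 2 * ι ℂ 3) (ι ℂ 3 * ι ℂ 2)
  | K'E : SRel q (ι ℂ 3 * ι ℂ 0) (q⁻¹ • (ι ℂ 0 * ι ℂ 3))
  | K'F : SRel q (ι ℂ 3 * ι ℂ 1) (q • (ι ℂ 1 * ι ℂ 3))
  | EF : SRel q ((q - q⁻¹) • (ι ℂ 0 * ι ℂ 1 - ι ℂ 1 * ι ℂ 0))
      (ι ℂ 2 * ι ℂ 2 - ι ℂ 3 * ι ℂ 3)

/-- The algebra `S`, presented by generators `E, F, K, K′` and the relations above. -/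
abbrev SAlg (q : ℂ) : Type := RingQuot (SRel q)

/-- The generator `E` of `S`. -/
def gE (q : ℂ) : SAlg q := RingQuot.mkAlgHom ℂ (SRel q) (ι ℂ 0)

/-- The generator `F` of `S`. -/
def gF (q : ℂ) : SAlg q := RingQuot.mkAlgHom ℂ (SRel q) (ι ℂ 1)

/-- The generator `K` of `S`. -/
def gK (q : ℂ) : SAlg q := RingQuot.mkAlgHom ℂ (SRel q) (ι ℂ 2)

/-- The generator `K′` of `S`. -/
def gK' (q : ℂ) : SAlg q := RingQuot.mkAlgHom ℂ (SRel q) (ι ℂ 3)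


/-- The degree-1 component `S₁` of `S`, spanned by the generators. -/
def S1 (q : ℂ) : Submodule ℂ (SAlg q) :=
  Submodule.span ℂ {gE q, gF q, gK q, gK' q}

/-- `X = ξ₃η₄E − ξ₁η₄K − ξ₃η₁K′`. -/
def lX (q ξ1 ξ3 η1 η4 : ℂ) : SAlg q :=
  (ξ3 * η4) • gE q - (ξ1 * η4) • gK q - (ξ3 * η1) • gK' q

/-- `Y = ξ₃η₄F − ξ₂η₄K − ξ₃η₂K′`. -/
def lY (q ξ2 ξ3 η2 η4 : ℂ) : SAlg q :=
  (ξ3 * η4) • gF q - (ξ2 * η4) • gK q - (ξ3 * η2) • gK' q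

/-- `X′ = ξ₃η₄E − qξ₁η₄K − qξ₃η₁K′`. -/
def lX' (q ξ1 ξ3 η1 η4 : ℂ) : SAlg q :=
  (ξ3 * η4) • gE q - (q * ξ1 * η4) • gK q - (q * ξ3 * η1) • gK' q

/-- `Y′ = ξ₃η₄F − q⁻¹ξ₂η₄K − q⁻¹ξ₃η₂K′`. -/
def lY' (q ξ2 ξ3 η2 η4 : ℂ) : SAlg q :=
  (ξ3 * η4) • gF q - (q⁻¹ * ξ2 * η4) • gK q - (q⁻¹ * ξ3 * η2) • gK' q

/-- The left ideal `SX + SY` defining the line module `M_{p,p′}`. -/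
def Imod (q ξ1 ξ2 ξ3 η1 η2 η4 : ℂ) : Submodule (SAlg q) (SAlg q) :=
  Submodule.span (SAlg q) {lX q ξ1 ξ3 η1 η4, lY q ξ2 ξ3 η2 η4}

/-- The left ideal `SX′ + SY′` defining the line module `M_{σp,σ⁻¹p′}`. -/
def Imod' (q ξ1 ξ2 ξ3 η1 η2 η4 : ℂ) : Submodule (SAlg q) (SAlg q) :=
  Submodule.span (SAlg q) {lX' q ξ1 ξ3 η1 η4, lY' q ξ2 ξ3 η2 η4}

/-- The left ideal `SX + SY + SK′` defining the point module `M_p`. -/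
def Jmod (q ξ1 ξ2 ξ3 η1 η2 η4 : ℂ) : Submodule (SAlg q) (SAlg q) :=
  Submodule.span (SAlg q) {lX q ξ1 ξ3 η1 η4, lY q ξ2 ξ3 η2 η4, gK' q}

lemma Imod_le (q ξ1 ξ2 ξ3 η1 η2 η4 : ℂ) :
    Imod q ξ1 ξ2 ξ3 η1 η2 η4
      ≤ Submodule.comap LinearMap.id (Jmod q ξ1 ξ2 ξ3 η1 η2 η4) := by
  rw [Submodule.comap_id]
  apply Submodule.span_mono
  intro z hz
  simp only [Set.mem_insert_iff, Set.mem_singleton_iff] at hz ⊢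
  tauto

lemma gK_mul_gE (q : ℂ) : gK q * gE q = q • (gE q * gK q) := by
  simpa [gK, gE] using RingQuot.mkAlgHom_rel ℂ (SRel.KE (q := q))

lemma gK_mul_gF (q : ℂ) : gK q * gF q = q⁻¹ • (gF q * gK q) := by
  simpa [gK, gF] using RingQuot.mkAlgHom_rel ℂ (SRel.KF (q := q))

lemma gK_mul_gK' (q : ℂ) : gK q * gK' q = gK' q * gK q := by
  simpa [gK, gK'] using RingQuot.mkAlgHom_rel ℂ (SRel.KK' (q := q))

lemma gK'_mul_gE (q : ℂ) : gK' q * gE q = q⁻¹ • (gE q * gK' q) := by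
  simpa [gK', gE] using RingQuot.mkAlgHom_rel ℂ (SRel.K'E (q := q))

lemma gK'_mul_gF (q : ℂ) : gK' q * gF q = q • (gF q * gK' q) := by
  simpa [gK', gF] using RingQuot.mkAlgHom_rel ℂ (SRel.K'F (q := q))

lemma gE_mul_gK {q : ℂ} (hq : q ≠ 0) : gE q * gK q = q⁻¹ • (gK q * gE q) := by
  rw [gK_mul_gE, inv_smul_smul₀ hq]

lemma gF_mul_gK {q : ℂ} (hq : q ≠ 0) : gF q * gK q = q • (gK q * gF q) := by
  rw [gK_mul_gF, smul_inv_smul₀ hq]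

lemma gE_mul_gK' {q : ℂ} (hq : q ≠ 0) : gE q * gK' q = q • (gK' q * gE q) := by
  rw [gK'_mul_gE, smul_inv_smul₀ hq]

lemma gF_mul_gK' {q : ℂ} (hq : q ≠ 0) : gF q * gK' q = q⁻¹ • (gK' q * gF q) := by
  rw [gK'_mul_gF, inv_smul_smul₀ hq]

lemma mul_pow_of_mul_eq_smul {A : Type*} [Ring A] [Algebra ℂ A] {x y : A} {c : ℂ}
    (h : x * y = c • (y * x)) (n : ℕ) : x * y ^ n = c ^ n • (y ^ n * x) := by
  induction n with
  | zero => simp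
  | succ n ih =>
    rw [pow_succ, ← mul_assoc, ih, smul_mul_assoc, mul_assoc, h, mul_smul_comm, smul_smul,
      ← mul_assoc, pow_succ c]

lemma gE_mul_monomial {q : ℂ} (hq : q ≠ 0) (i j : ℕ) :
    gE q * (gK q ^ i * gK' q ^ j) = (q⁻¹ ^ i * q ^ j) • (gK q ^ i * gK' q ^ j * gE q) := by
  rw [← mul_assoc, mul_pow_of_mul_eq_smul (gE_mul_gK hq), smul_mul_assoc, mul_assoc,
    mul_pow_of_mul_eq_smul (gE_mul_gK' hq), mul_smul_comm, smul_smul, ← mul_assoc]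

lemma gF_mul_monomial {q : ℂ} (hq : q ≠ 0) (i j : ℕ) :
    gF q * (gK q ^ i * gK' q ^ j) = (q ^ i * q⁻¹ ^ j) • (gK q ^ i * gK' q ^ j * gF q) := by
  rw [← mul_assoc, mul_pow_of_mul_eq_smul (gF_mul_gK hq), smul_mul_assoc, mul_assoc,
    mul_pow_of_mul_eq_smul (gF_mul_gK' hq), mul_smul_comm, smul_smul, ← mul_assoc]

lemma monomial_mul_gK (q : ℂ) (i j : ℕ) :
    gK q ^ i * gK' q ^ j * gK q = gK q ^ (i + 1) * gK' q ^ j := by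
  have h : Commute (gK' q ^ j) (gK q) := Commute.pow_left (gK_mul_gK' q).symm j
  rw [mul_assoc, h.eq, ← mul_assoc, pow_succ]

lemma monomial_mul_gK' (q : ℂ) (i j : ℕ) :
    gK q ^ i * gK' q ^ j * gK' q = gK q ^ i * gK' q ^ (j + 1) := by
  rw [mul_assoc, pow_succ]

lemma gK_mul_monomial (q : ℂ) (i j : ℕ) :
    gK q * (gK q ^ i * gK' q ^ j) = gK q ^ (i + 1) * gK' q ^ j := by
  rw [← mul_assoc, pow_succ']

lemma gK'_mul_monomial (q : ℂ) (i j : ℕ) :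
    gK' q * (gK q ^ i * gK' q ^ j) = gK q ^ i * gK' q ^ (j + 1) := by
  have h : Commute (gK' q) (gK q ^ i) := Commute.pow_right (gK_mul_gK' q).symm i
  rw [← mul_assoc, h.eq, mul_assoc, pow_succ']

/-- The left ideal generated by `E - αK - βK′` and `F - γK - δK′`. -/
def lineIdeal (q α β γ δ : ℂ) : Submodule (SAlg q) (SAlg q) :=
  Submodule.span (SAlg q)
    {gE q - α • gK q - β • gK' q, gF q - γ • gK q - δ • gK' q}

/-- The vector space with basis indexed by the monomials `KⁱK′ʲ`. -/
abbrev LineSpace : Type := (ℕ × ℕ) →₀ ℂ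

/-- The basis vector of `LineSpace` corresponding to `KⁱK′ʲ`. -/
def monoVec (i j : ℕ) : LineSpace := Finsupp.single (i, j) 1

/-- The linear map from `LineSpace` sending the basis vector `(i, j)` to `f i j`. -/
def monoLift {M : Type*} [AddCommGroup M] [Module ℂ M] (f : ℕ → ℕ → M) : LineSpace →ₗ[ℂ] M :=
  Finsupp.linearCombination ℂ fun p : ℕ × ℕ => f p.1 p.2

@[simp]
lemma monoLift_monoVec {M : Type*} [AddCommGroup M] [Module ℂ M] (f : ℕ → ℕ → M) (i j : ℕ) :
    monoLift f (monoVec i j) = f i j := by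
  simp [monoLift, monoVec]

lemma lineSpace_hom_ext {M : Type*} [AddCommGroup M] [Module ℂ M] {f g : LineSpace →ₗ[ℂ] M}
    (h : ∀ i j, f (monoVec i j) = g (monoVec i j)) : f = g := by
  ext ⟨i, j⟩
  simpa [monoVec] using h i j

/-- The action of the four generators on `LineSpace`. -/
def lineOp (q α β γ δ : ℂ) : Fin 4 → Module.End ℂ LineSpace :=
  ![monoLift fun i j => (q⁻¹ ^ i * q ^ j) • (α • monoVec (i + 1) j + β • monoVec i (j + 1)),
    monoLift fun i j => (q ^ i * q⁻¹ ^ j) • (γ • monoVec (i + 1) j + δ • monoVec i (j + 1)),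
    monoLift fun i j => monoVec (i + 1) j,
    monoLift fun i j => monoVec i (j + 1)]

lemma lineOp_rel {q α β γ δ : ℂ} (hq : q ≠ 0)
    (hαγ : (q - q⁻¹) ^ 2 * (α * γ) = -1) (hβδ : (q - q⁻¹) ^ 2 * (β * δ) = -1)
    ⦃x y : FreeAlgebra ℂ (Fin 4)⦄ (h : SRel q x y) :
    FreeAlgebra.lift ℂ (lineOp q α β γ δ) x = FreeAlgebra.lift ℂ (lineOp q α β γ δ) y := by
  have hpow (n : ℕ) : q ^ n * q⁻¹ ^ n = 1 := by
    rw [← mul_pow, mul_inv_cancel₀ hq, one_pow]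
  cases h
  case EF =>
    refine lineSpace_hom_ext fun i j => ?_
    simp only [lineOp, map_smul, map_sub, map_mul, FreeAlgebra.lift_ι_apply, Matrix.cons_val,
      LinearMap.smul_apply, LinearMap.sub_apply, Module.End.mul_apply, monoLift_monoVec, map_add]
    have hi := hpow i
    have hj := hpow j
    match_scalars
    · linear_combination -(q ^ i * q⁻¹ ^ i * (q ^ j * q⁻¹ ^ j)) * hαγ
        + q ^ j * q⁻¹ ^ j * hi + hj
    · ring
    · linear_combination (q ^ i * q⁻¹ ^ i * (q ^ j * q⁻¹ ^ j)) * hβδ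
        - q ^ j * q⁻¹ ^ j * hi - hj
  all_goals
    refine lineSpace_hom_ext fun i j => ?_
    simp only [lineOp, map_smul, map_mul, FreeAlgebra.lift_ι_apply, Matrix.cons_val,
      LinearMap.smul_apply, Module.End.mul_apply, monoLift_monoVec, map_add]
  all_goals first | rfl | (match_scalars <;> simp only [inv_pow, pow_succ] <;> field_simp)

/-- The action of `S` on the line module with basis the monomials `KⁱK′ʲ`. -/
def lineRep {q α β γ δ : ℂ} (hq : q ≠ 0)
    (hαγ : (q - q⁻¹) ^ 2 * (α * γ) = -1) (hβδ : (q - q⁻¹) ^ 2 * (β * δ) = -1) :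
    SAlg q →ₐ[ℂ] Module.End ℂ LineSpace :=
  RingQuot.liftAlgHom ℂ ⟨FreeAlgebra.lift ℂ (lineOp q α β γ δ), lineOp_rel hq hαγ hβδ⟩

/-- The linear map `LineSpace → S` sending the basis vector `(i, j)` to `KⁱK′ʲ`. -/
def toAlg (q : ℂ) : LineSpace →ₗ[ℂ] SAlg q :=
  monoLift fun i j => gK q ^ i * gK' q ^ j

/-- Right multiplication by `K′` on `LineSpace`. -/
def shift : LineSpace →ₗ[ℂ] LineSpace :=
  Finsupp.lmapDomain ℂ ℂ fun p : ℕ × ℕ => (p.1, p.2 + 1)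

lemma shift_injective : Function.Injective shift :=
  Finsupp.mapDomain_injective fun p p' h => by
    simpa [Prod.ext_iff] using h

lemma toAlg_mul_gK' (q : ℂ) (f : LineSpace) : toAlg q f * gK' q = toAlg q (shift f) := by
  have h : LinearMap.mulRight ℂ (gK' q) ∘ₗ toAlg q = toAlg q ∘ₗ shift := by
    refine lineSpace_hom_ext fun i j => ?_
    have hs : shift (monoVec i j) = monoVec i (j + 1) := by simp [shift, monoVec]
    simp [hs, toAlg, monomial_mul_gK']
  exact LinearMap.congr_fun h f

section Representation

variable {q α β γ δ : ℂ} (hq : q ≠ 0)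
  (hαγ : (q - q⁻¹) ^ 2 * (α * γ) = -1) (hβδ : (q - q⁻¹) ^ 2 * (β * δ) = -1)

lemma lineRep_mkAlgHom (x : FreeAlgebra ℂ (Fin 4)) :
    lineRep hq hαγ hβδ (RingQuot.mkAlgHom ℂ (SRel q) x)
      = FreeAlgebra.lift ℂ (lineOp q α β γ δ) x := by
  simp [lineRep]

lemma lineRep_gK_monoVec (i j : ℕ) :
    lineRep hq hαγ hβδ (gK q) (monoVec i j) = monoVec (i + 1) j := by
  simp [gK, lineRep_mkAlgHom, lineOp]

lemma lineRep_gK'_monoVec (i j : ℕ) :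
    lineRep hq hαγ hβδ (gK' q) (monoVec i j) = monoVec i (j + 1) := by
  simp [gK', lineRep_mkAlgHom, lineOp]

lemma lineRep_gE_monoVec (i j : ℕ) :
    lineRep hq hαγ hβδ (gE q) (monoVec i j)
      = (q⁻¹ ^ i * q ^ j) • (α • monoVec (i + 1) j + β • monoVec i (j + 1)) := by
  simp only [gE, lineRep_mkAlgHom, lineOp, FreeAlgebra.lift_ι_apply, Matrix.cons_val,
    monoLift_monoVec]

lemma lineRep_gF_monoVec (i j : ℕ) :
    lineRep hq hαγ hβδ (gF q) (monoVec i j)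
      = (q ^ i * q⁻¹ ^ j) • (γ • monoVec (i + 1) j + δ • monoVec i (j + 1)) := by
  simp only [gF, lineRep_mkAlgHom, lineOp, FreeAlgebra.lift_ι_apply, Matrix.cons_val,
    monoLift_monoVec]

lemma lineRep_toAlg (f : LineSpace) : lineRep hq hαγ hβδ (toAlg q f) (monoVec 0 0) = f := by
  have hK (i j : ℕ) : (lineRep hq hαγ hβδ (gK q) ^ i) (monoVec 0 j) = monoVec i j := by
    induction i with
    | zero => simp
    | succ i ih => rw [pow_succ', Module.End.mul_apply, ih, lineRep_gK_monoVec]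
  have hK' (j : ℕ) : (lineRep hq hαγ hβδ (gK' q) ^ j) (monoVec 0 0) = monoVec 0 j := by
    induction j with
    | zero => simp
    | succ j ih => rw [pow_succ', Module.End.mul_apply, ih, lineRep_gK'_monoVec]
  have h : LinearMap.applyₗ (monoVec 0 0) ∘ₗ (lineRep hq hαγ hβδ).toLinearMap ∘ₗ toAlg q
      = LinearMap.id := by
    refine lineSpace_hom_ext fun i j => ?_
    simp [toAlg, hK, hK']
  exact LinearMap.congr_fun h f

lemma lineRep_apply_eq_zero {a : SAlg q} (ha : a ∈ lineIdeal q α β γ δ) :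
    lineRep hq hαγ hβδ a (monoVec 0 0) = 0 := by
  induction ha using Submodule.span_induction with
  | mem x hx =>
    rcases hx with rfl | rfl <;>
    simp [lineRep_gE_monoVec, lineRep_gF_monoVec, lineRep_gK_monoVec, lineRep_gK'_monoVec]
  | zero => simp
  | add x y _ _ hx hy => simp [hx, hy]
  | smul r x _ hx => simp [hx]

lemma mul_toAlg_sub_mem_of_monoVec {g : SAlg q}
    (h : ∀ i j, g * toAlg q (monoVec i j)
      - toAlg q (lineRep hq hαγ hβδ g (monoVec i j)) ∈ lineIdeal q α β γ δ) (f : LineSpace) :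
    g * toAlg q f - toAlg q (lineRep hq hαγ hβδ g f) ∈ lineIdeal q α β γ δ := by
  have key : ((lineIdeal q α β γ δ).restrictScalars ℂ).mkQ ∘ₗ
      (LinearMap.mulLeft ℂ g ∘ₗ toAlg q - toAlg q ∘ₗ lineRep hq hαγ hβδ g) = 0 := by
    refine lineSpace_hom_ext fun i j => ?_
    exact (Submodule.Quotient.mk_eq_zero _).2 (h i j)
  exact (Submodule.Quotient.mk_eq_zero _).1 (LinearMap.congr_fun key f)

lemma mul_toAlg_sub_mem (a : SAlg q) (f : LineSpace) :
    a * toAlg q f - toAlg q (lineRep hq hαγ hβδ a f) ∈ lineIdeal q α β γ δ := by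
  obtain ⟨x, rfl⟩ := RingQuot.mkAlgHom_surjective ℂ (SRel q) a
  induction x using FreeAlgebra.induction generalizing f with
  | grade0 r => simp [Algebra.algebraMap_eq_smul_one]
  | add x y hx hy =>
    convert add_mem (hx f) (hy f) using 1
    simp only [map_add, add_mul, LinearMap.add_apply]
    abel
  | mul x y hx hy =>
    convert add_mem (Submodule.smul_mem _ (RingQuot.mkAlgHom ℂ (SRel q) x) (hy f))
      (hx (lineRep hq hαγ hβδ (RingQuot.mkAlgHom ℂ (SRel q) y) f)) using 1
    simp only [map_mul, Module.End.mul_apply, smul_eq_mul, mul_sub, mul_assoc]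
    abel
  | grade1 k =>
    refine mul_toAlg_sub_mem_of_monoVec hq hαγ hβδ (fun i j => ?_) f
    have hXY := Submodule.subset_span (R := SAlg q)
      (s := {gE q - α • gK q - β • gK' q, gF q - γ • gK q - δ • gK' q})
    fin_cases k
    · change gE q * _ - toAlg q (lineRep hq hαγ hβδ (gE q) _) ∈ _
      convert Submodule.smul_mem (lineIdeal q α β γ δ)
        ((q⁻¹ ^ i * q ^ j) • (gK q ^ i * gK' q ^ j)) (hXY (Set.mem_insert _ _)) using 1
      simp only [lineRep_gE_monoVec, map_smul, map_add, toAlg, monoLift_monoVec,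
        gE_mul_monomial hq, smul_eq_mul, mul_sub, smul_mul_assoc, mul_smul_comm,
        monomial_mul_gK, monomial_mul_gK', smul_add]
      module
    · change gF q * _ - toAlg q (lineRep hq hαγ hβδ (gF q) _) ∈ _
      convert Submodule.smul_mem (lineIdeal q α β γ δ)
        ((q ^ i * q⁻¹ ^ j) • (gK q ^ i * gK' q ^ j))
        (hXY (Set.mem_insert_of_mem _ rfl)) using 1
      simp only [lineRep_gF_monoVec, map_smul, map_add, toAlg, monoLift_monoVec,
        gF_mul_monomial hq, smul_eq_mul, mul_sub, smul_mul_assoc, mul_smul_comm,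
        monomial_mul_gK, monomial_mul_gK', smul_add]
      module
    · change gK q * _ - toAlg q (lineRep hq hαγ hβδ (gK q) _) ∈ _
      simp [lineRep_gK_monoVec, toAlg, gK_mul_monomial]
    · change gK' q * _ - toAlg q (lineRep hq hαγ hβδ (gK' q) _) ∈ _
      simp [lineRep_gK'_monoVec, toAlg, gK'_mul_monomial]

end Representation

/-- Every element of `S` is a combination of the monomials `KⁱK′ʲ` modulo the line ideal. -/
lemma exists_sub_toAlg_mem {q α β γ δ : ℂ} (hq : q ≠ 0)
    (hαγ : (q - q⁻¹) ^ 2 * (α * γ) = -1) (hβδ : (q - q⁻¹) ^ 2 * (β * δ) = -1) (a : SAlg q) :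
    ∃ f, a - toAlg q f ∈ lineIdeal q α β γ δ :=
  ⟨lineRep hq hαγ hβδ a (monoVec 0 0), by
    simpa [toAlg] using mul_toAlg_sub_mem hq hαγ hβδ a (monoVec 0 0)⟩


lemma mul_gK'_mem_of_gens {q : ℂ} {s : Set (SAlg q)} {I : Submodule (SAlg q) (SAlg q)}
    (h : ∀ x ∈ s, x * gK' q ∈ I) {a : SAlg q} (ha : a ∈ Submodule.span (SAlg q) s) :
    a * gK' q ∈ I := by
  have hle : Submodule.span (SAlg q) s
      ≤ I.comap (LinearMap.toSpanSingleton (SAlg q) (SAlg q) (gK' q)) :=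
    Submodule.span_le.2 fun x hx => by simpa using h x hx
  simpa using hle ha

/-- If `a * K′` lies in a line ideal, then `a` lies in any line ideal whose right translate by
`K′` is contained in the first. -/
lemma mem_lineIdeal_of_mul_gK'_mem {q α β γ δ α' β' γ' δ' : ℂ} (hq : q ≠ 0)
    (hαγ : (q - q⁻¹) ^ 2 * (α * γ) = -1) (hβδ : (q - q⁻¹) ^ 2 * (β * δ) = -1)
    (hαγ' : (q - q⁻¹) ^ 2 * (α' * γ') = -1) (hβδ' : (q - q⁻¹) ^ 2 * (β' * δ') = -1)
    (hmul : ∀ x ∈ lineIdeal q α' β' γ' δ', x * gK' q ∈ lineIdeal q α β γ δ)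
    {a : SAlg q} (ha : a * gK' q ∈ lineIdeal q α β γ δ) : a ∈ lineIdeal q α' β' γ' δ' := by
  obtain ⟨f, hf⟩ := exists_sub_toAlg_mem hq hαγ' hβδ' a
  have hshift : toAlg q (shift f) ∈ lineIdeal q α β γ δ := by
    have := sub_mem ha (hmul _ hf)
    rwa [sub_mul, sub_sub_cancel, toAlg_mul_gK'] at this
  have h0 : shift f = 0 := by
    rw [← lineRep_toAlg hq hαγ hβδ (shift f)]
    exact lineRep_apply_eq_zero hq hαγ hβδ hshift
  have hf0 : f = 0 := shift_injective (by rw [h0, map_zero])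
  simpa [hf0] using hf

lemma span_smul_pair_eq {A : Type*} [Ring A] [Algebra ℂ A] {c : ℂ} (hc : c ≠ 0) (x y : A) :
    Submodule.span A {c • x, c • y} = Submodule.span A {x, y} := by
  have hu : IsUnit (algebraMap ℂ A c) := (isUnit_iff_ne_zero.2 hc).map _
  rw [Submodule.span_insert, Submodule.span_insert, Algebra.smul_def, Algebra.smul_def,
    ← smul_eq_mul, ← smul_eq_mul, Submodule.span_singleton_smul_eq hu,
    Submodule.span_singleton_smul_eq hu]

lemma Imod_eq_lineIdeal (q ξ1 ξ2 : ℂ) {ξ3 : ℂ} (η1 η2 : ℂ) {η4 : ℂ} (hξ3 : ξ3 ≠ 0)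
    (hη4 : η4 ≠ 0) :
    Imod q ξ1 ξ2 ξ3 η1 η2 η4 = lineIdeal q (ξ1 / ξ3) (η1 / η4) (ξ2 / ξ3) (η2 / η4) := by
  rw [lineIdeal, ← span_smul_pair_eq (mul_ne_zero hξ3 hη4), Imod]
  congr 2
  · rw [lX]
    match_scalars <;> field_simp
  · rw [lY]
    congr 1
    match_scalars <;> field_simp

lemma Imod'_eq_Imod (q ξ1 ξ2 ξ3 η1 η2 η4 : ℂ) :
    Imod' q ξ1 ξ2 ξ3 η1 η2 η4 = Imod q (q * ξ1) (q⁻¹ * ξ2) ξ3 (q * η1) (q⁻¹ * η2) η4 := by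
  simp only [Imod, Imod', lX, lY, lX', lY', mul_left_comm ξ3 q, mul_left_comm ξ3 q⁻¹, mul_assoc]

lemma lX'_mul_gK' {q : ℂ} (hq : q ≠ 0) (ξ1 ξ3 η1 η4 : ℂ) :
    lX' q ξ1 ξ3 η1 η4 * gK' q = q • (gK' q * lX q ξ1 ξ3 η1 η4) := by
  simp only [lX', lX, sub_mul, mul_sub, smul_mul_assoc, mul_smul_comm, gE_mul_gK' hq, gK_mul_gK']
  module

lemma lY'_mul_gK' {q : ℂ} (hq : q ≠ 0) (ξ2 ξ3 η2 η4 : ℂ) :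
    lY' q ξ2 ξ3 η2 η4 * gK' q = q⁻¹ • (gK' q * lY q ξ2 ξ3 η2 η4) := by
  simp only [lY', lY, sub_mul, mul_sub, smul_mul_assoc, mul_smul_comm, gF_mul_gK' hq, gK_mul_gK']
  module

lemma mul_gK'_mem_Imod {q : ℂ} (hq : q ≠ 0) (ξ1 ξ2 ξ3 η1 η2 η4 : ℂ) {a : SAlg q}
    (ha : a ∈ Imod' q ξ1 ξ2 ξ3 η1 η2 η4) : a * gK' q ∈ Imod q ξ1 ξ2 ξ3 η1 η2 η4 := by
  refine mul_gK'_mem_of_gens (fun x hx => ?_) ha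
  rcases hx with rfl | rfl
  · rw [lX'_mul_gK' hq, ← smul_mul_assoc]
    exact Submodule.smul_mem _ _ (Submodule.subset_span (Set.mem_insert _ _))
  · rw [lY'_mul_gK' hq, ← smul_mul_assoc]
    exact Submodule.smul_mem _ _ (Submodule.subset_span (Set.mem_insert_of_mem _ rfl))

lemma mem_Jmod_iff (q ξ1 ξ2 ξ3 η1 η2 η4 : ℂ) (b : SAlg q) :
    b ∈ Jmod q ξ1 ξ2 ξ3 η1 η2 η4 ↔ ∃ a, a * gK' q - b ∈ Imod q ξ1 ξ2 ξ3 η1 η2 η4 := by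
  have hJ : Jmod q ξ1 ξ2 ξ3 η1 η2 η4
      = Imod q ξ1 ξ2 ξ3 η1 η2 η4 ⊔ Submodule.span (SAlg q) {gK' q} := by
    rw [Jmod, Imod, ← Submodule.span_union]
    congr 1
    ext
    simp only [Set.mem_union, Set.mem_insert_iff, Set.mem_singleton_iff, or_assoc]
  rw [hJ, Submodule.mem_sup]
  constructor
  · rintro ⟨x, hx, y, hy, rfl⟩
    obtain ⟨a, rfl⟩ := Submodule.mem_span_singleton.1 hy
    exact ⟨a, by simpa using hx⟩
  · rintro ⟨a, ha⟩
    exact ⟨-(a * gK' q - b), neg_mem ha, a • gK' q, Submodule.mem_span_singleton.2 ⟨a, rfl⟩,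
      by simp⟩

/-- The slopes of a point on the conic satisfy the normalised conic equation. -/
lemma conic_normalised {q κ x y z : ℂ} (hκ : κ = (q⁻¹ - q)⁻¹) (hq : q⁻¹ - q ≠ 0)
    (h : x * y + κ ^ 2 * z ^ 2 = 0) (hz : z ≠ 0) : (q - q⁻¹) ^ 2 * (x / z * (y / z)) = -1 := by
  have hxy : x * y = -(κ ^ 2 * z ^ 2) := eq_neg_of_add_eq_zero_left h
  have h1 : (q⁻¹ - q) * κ = 1 := by rw [hκ, mul_inv_cancel₀ hq]
  rw [div_mul_div_comm, hxy, ← sq, neg_div, mul_div_assoc, div_self (pow_ne_zero 2 hz)]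
  linear_combination (-(q⁻¹ - q) * κ - 1) * h1

/-- (i) `X′K′ = qK′X` and `Y′K′ = q⁻¹K′Y` in `S`; (ii) `a ↦ aK′` induces a well-defined
injective homomorphism of left `S`-modules `S/(SX′+SY′) → S/(SX+SY)` raising degrees by
one, whose image is exactly the kernel of the canonical surjection
`S/(SX+SY) → S/(SX+SY+SK′)`; i.e. there is an exact sequence
`0 → M_{σp,σ⁻¹p′}(−1) → M_{p,p′} → M_p → 0`. -/
theorem stmt_13 (q : ℂ) (hq0 : q ≠ 0) (hroot : ∀ m : ℕ, 0 < m → q ^ m ≠ 1)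
    (κ : ℂ) (hκ : κ = (q⁻¹ - q)⁻¹)
    (ξ1 ξ2 ξ3 η1 η2 η4 : ℂ)
    (hp : ξ1 * ξ2 + κ ^ 2 * ξ3 ^ 2 = 0) (hξ3 : ξ3 ≠ 0)
    (hp' : η1 * η2 + κ ^ 2 * η4 ^ 2 = 0) (hη4 : η4 ≠ 0) :
    -- (i)
    (lX' q ξ1 ξ3 η1 η4 * gK' q = q • (gK' q * lX q ξ1 ξ3 η1 η4)
      ∧ lY' q ξ2 ξ3 η2 η4 * gK' q = q⁻¹ • (gK' q * lY q ξ2 ξ3 η2 η4))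
    -- (ii)
    ∧ ∃ ψ : (SAlg q ⧸ Imod' q ξ1 ξ2 ξ3 η1 η2 η4)
        →ₗ[SAlg q] (SAlg q ⧸ Imod q ξ1 ξ2 ξ3 η1 η2 η4),
      (∀ a : SAlg q,
        ψ (Submodule.Quotient.mk a) = Submodule.Quotient.mk (a * gK' q))
      ∧ Function.Injective ψ
      -- `ψ` raises degrees by one
      ∧ (∀ (m : ℕ) (a : SAlg q), a ∈ S1 q ^ m →
          ∃ b ∈ S1 q ^ (m + 1), ψ (Submodule.Quotient.mk a) = Submodule.Quotient.mk b)
      -- the image of `ψ` is the kernel of the canonical map `M_{p,p′} → M_p`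
      ∧ LinearMap.range ψ
          = LinearMap.ker
              (Submodule.mapQ (Imod q ξ1 ξ2 ξ3 η1 η2 η4) (Jmod q ξ1 ξ2 ξ3 η1 η2 η4)
                LinearMap.id (Imod_le q ξ1 ξ2 ξ3 η1 η2 η4)) := by
  have hq : q⁻¹ - q ≠ 0 := fun h => hroot 2 two_pos <| by
    rw [sq]
    nth_rewrite 1 [← sub_eq_zero.1 h]
    exact inv_mul_cancel₀ hq0
  have hmul (a : SAlg q) (ha : a ∈ Imod' q ξ1 ξ2 ξ3 η1 η2 η4) :
      a * gK' q ∈ Imod q ξ1 ξ2 ξ3 η1 η2 η4 := mul_gK'_mem_Imod hq0 _ _ _ _ _ _ ha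
  have hle : Imod' q ξ1 ξ2 ξ3 η1 η2 η4 ≤ (Imod q ξ1 ξ2 ξ3 η1 η2 η4).comap
      (LinearMap.toSpanSingleton (SAlg q) (SAlg q) (gK' q)) :=
    fun a ha => by simpa using hmul a ha
  have hψ (a : SAlg q) : Submodule.mapQ _ _ _ hle (Submodule.Quotient.mk a)
      = Submodule.Quotient.mk (a * gK' q) := by simp
  refine ⟨⟨lX'_mul_gK' hq0 _ _ _ _, lY'_mul_gK' hq0 _ _ _ _⟩,
    Submodule.mapQ _ _ _ hle, hψ, ?_, ?_, ?_⟩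
  · rw [injective_iff_map_eq_zero]
    intro x hx
    obtain ⟨a, rfl⟩ := Submodule.Quotient.mk_surjective _ x
    rw [hψ, Submodule.Quotient.mk_eq_zero, Imod_eq_lineIdeal q _ _ _ _ hξ3 hη4] at hx
    simp only [Imod'_eq_Imod, Imod_eq_lineIdeal q _ _ _ _ hξ3 hη4] at hmul
    rw [Submodule.Quotient.mk_eq_zero, Imod'_eq_Imod, Imod_eq_lineIdeal q _ _ _ _ hξ3 hη4]
    have hconic {x y z : ℂ} (h : x * y + κ ^ 2 * z ^ 2 = 0) :
        q * x * (q⁻¹ * y) + κ ^ 2 * z ^ 2 = 0 := by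
      rw [← h, mul_mul_mul_comm, mul_inv_cancel₀ hq0, one_mul]
    exact mem_lineIdeal_of_mul_gK'_mem hq0 (conic_normalised hκ hq hp hξ3)
      (conic_normalised hκ hq hp' hη4) (conic_normalised hκ hq (hconic hp) hξ3)
      (conic_normalised hκ hq (hconic hp') hη4) hmul hx
  · intro m a ha
    refine ⟨a * gK' q, ?_, hψ a⟩
    rw [pow_succ]
    exact Submodule.mul_mem_mul ha (Submodule.subset_span (by simp))
  · ext x
    obtain ⟨b, rfl⟩ := Submodule.Quotient.mk_surjective _ x
    rw [LinearMap.mem_range, LinearMap.mem_ker, Submodule.mapQ_apply, LinearMap.id_apply,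
      Submodule.Quotient.mk_eq_zero, mem_Jmod_iff]
    simp only [(Submodule.Quotient.mk_surjective _).exists, hψ, Submodule.Quotient.eq]
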